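/- arXiv:gr-qc/0601109 — 4 statements merged into one kernel-verified Lean document; each statement's English description precedes it below -/
import Mathlib

section
/- Let T be a symmetric 2-tensor on an n-dimensional (pseudo-)Riemannian manifold (M,g) satisfying the conformal equation ∇_(a T_bc) = S{g ⊗ t}_abc (with t = 0 for a Killing tensor). If x and y are eigenvector fields of T associated with the same eigenvalue function ρ, then (T − ρ g){x,y} = g(x,y) s + g(s,x) y + g(s,y) x, where s = dρ − t and {x,y} = ∇_x y + ∇_y x. -/
/- An algebraic model of the differential geometry of an n-dimensional
(pseudo-)Riemannian manifold: `F` models the ring of smooth real functions,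
`X` the `F`-module of vector fields, `act` the action of vector fields on
functions by derivation, `bracket` the Lie bracket, `g` the metric, `conn`
the Levi-Civita connection and `e`, `eps` a (pseudo-)orthonormal frame
recording the dimension and the signature. -/

noncomputable section

namespace KCT

/-- complex multiplication on pairs of functions -/
def cxMul {F : Type} [CommRing F] (a b : F × F) : F × F :=
  (a.1 * b.1 - a.2 * b.2, a.1 * b.2 + a.2 * b.1)

/-- the imaginary unit -/
def cxI {F : Type} [CommRing F] : F × F := (0, 1)

/-- complex conjugation -/
def cxConj {F : Type} [CommRing F] (a : F × F) : F × F := (a.1, -a.2)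

def cxSmul {F : Type} [CommRing F] (f : F) (a : F × F) : F × F := (f * a.1, f * a.2)

/-- complex inverse (meaningful when the squared modulus is invertible) -/
def cxInv {F : Type} [CommRing F] (a : F × F) : F × F :=
  cxSmul (Ring.inverse (a.1 * a.1 + a.2 * a.2)) (cxConj a)

/-- The underlying (local) smooth manifold: smooth functions `F`,
vector fields `X`, derivations and Lie bracket. -/
structure Man where
  F : Type
  [instCRF : CommRing F]
  [instAlg : Algebra ℝ F]
  X : Type
  [instACG : AddCommGroup X]
  [instMod : Module F X]
  act : X → F → F
  bracket : X → X → X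
  act_addf : ∀ x f₁ f₂, act x (f₁ + f₂) = act x f₁ + act x f₂
  act_mulf : ∀ x f₁ f₂, act x (f₁ * f₂) = act x f₁ * f₂ + f₁ * act x f₂
  act_addv : ∀ x y f, act (x + y) f = act x f + act y f
  act_smulv : ∀ (h : F) x f, act (h • x) f = h * act x f
  act_const : ∀ x r, act x (algebraMap ℝ F r) = 0
  /-- pointwise positivity of a function -/
  Pos : F → Prop
  pos_one : Pos 1
  pos_mul : ∀ f h, Pos f → Pos h → Pos (f * h)
  pos_unit : ∀ f, Pos f → IsUnit f
  sq_pos : ∀ f, IsUnit f → Pos (f * f)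
  /-- the exponential of a function -/
  fexp : F → F
  fexp_unit : ∀ f, IsUnit (fexp f)
  fexp_deriv : ∀ x f, act x (fexp f) = fexp f * act x f
  /-- locally, closed one-forms are exact -/
  closed_exact : ∀ ω : X → F, (∀ (f : F) x, ω (f • x) = f * ω x) →
    (∀ x y, ω (x + y) = ω x + ω y) →
    (∀ x y, act x (ω y) - act y (ω x) - ω (bracket x y) = 0) →
    ∃ f : F, ∀ x, ω x = act x f

attribute [instance] Man.instCRF Man.instAlg Man.instACG Man.instMod

/-- extension of the derivation action to complex valued functions -/
def Man.cxAct (M : Man) (x : M.X) (f : M.F × M.F) : M.F × M.F := (M.act x f.1, M.act x f.2)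

/-- An `n`-dimensional (pseudo-)Riemannian metric on `M` together with its
Levi-Civita connection and a (pseudo-)orthonormal frame. -/
structure Metric (M : Man) (n : ℕ) where
  g : M.X → M.X → M.F
  conn : M.X → M.X → M.X
  e : Fin n → M.X
  eps : Fin n → M.F
  g_symm : ∀ x y, g x y = g y x
  g_addl : ∀ x y z, g (x + y) z = g x z + g y z
  g_smull : ∀ (f : M.F) x y, g (f • x) y = f * g x y
  conn_addl : ∀ x y z, conn (x + y) z = conn x z + conn y z
  conn_smull : ∀ (f : M.F) x y, conn (f • x) y = f • conn x y
  conn_addr : ∀ x y z, conn x (y + z) = conn x y + conn x z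
  conn_leibniz : ∀ x (f : M.F) y, conn x (f • y) = M.act x f • y + f • conn x y
  torsion_free : ∀ x y, conn x y - conn y x = M.bracket x y
  metric_compat : ∀ x y z, M.act x (g y z) = g (conn x y) z + g y (conn x z)
  frame_on : ∀ i j, g (e i) (e j) = if i = j then eps i else 0
  eps_pm : ∀ i, eps i = 1 ∨ eps i = -1
  frame_complete : ∀ x, x = ∑ i, (eps i * g x (e i)) • e i

namespace Metric

variable {M : Man} {n : ℕ} (G : Metric M n)

/-- `{x,y} = ∇ₓ y + ∇_y x` -/
def sb (x y : M.X) : M.X := G.conn x y + G.conn y x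

/-- covariant derivative of a 2-tensor -/
def nabla2 (T : M.X → M.X → M.F) (x y z : M.X) : M.F :=
  M.act x (T y z) - T (G.conn x y) z - T y (G.conn x z)

/-- total symmetrization `∇_(a T_bc)` (cyclic sum) -/
def killingOp (T : M.X → M.X → M.F) (x y z : M.X) : M.F :=
  G.nabla2 T x y z + G.nabla2 T y z x + G.nabla2 T z x y

def Bilin (_G : Metric M n) (T : M.X → M.X → M.F) : Prop :=
  (∀ (f : M.F) x y, T (f • x) y = f * T x y) ∧ (∀ x y z, T (x + y) z = T x z + T y z) ∧
    (∀ (f : M.F) x y, T x (f • y) = f * T x y) ∧ (∀ x y z, T x (y + z) = T x y + T x z)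

def Symm2 (_G : Metric M n) (T : M.X → M.X → M.F) : Prop := ∀ x y, T x y = T y x

/-- second order Killing tensor: `∇_(a K_bc) = 0` -/
def IsKilling (T : M.X → M.X → M.F) : Prop :=
  G.Bilin T ∧ G.Symm2 T ∧ ∀ x y z, G.killingOp T x y z = 0

/-- the total symmetrization `S{g ⊗ t}` -/
def symG (t : M.X → M.F) (x y z : M.X) : M.F :=
  G.g x y * t z + G.g y z * t x + G.g z x * t y

/-- metric trace of a 2-tensor -/
def tr2 (T : M.X → M.X → M.F) : M.F := ∑ i, G.eps i * T (G.e i) (G.e i)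

/-- divergence `(∇·T)_c = ∇^a T_ac` -/
def div2 (T : M.X → M.X → M.F) (z : M.X) : M.F :=
  ∑ i, G.eps i * G.nabla2 T (G.e i) (G.e i) z

/-- the canonical 1-form `t = (2/(n+2)) ∇·T` of the conformal equation -/
def ct (T : M.X → M.X → M.F) (z : M.X) : M.F :=
  algebraMap ℝ M.F (2 / ((n : ℝ) + 2)) * G.div2 T z

/-- conformal equation with a prescribed 1-form `t` -/
def IsConformalWith (T : M.X → M.X → M.F) (t : M.X → M.F) : Prop :=
  G.Bilin T ∧ G.Symm2 T ∧ ∀ x y z, G.killingOp T x y z = G.symG t x y z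

/-- second order conformal tensor: `∇_(a T_bc) = S{g ⊗ t}`, `t = (2/(n+2)) ∇·T` -/
def IsConformal (T : M.X → M.X → M.F) : Prop := G.IsConformalWith T (G.ct T)

/-- the 1-form associated to a vector field -/
def flat (x z : M.X) : M.F := G.g x z

/-- exterior derivative of a 1-form -/
def d1 (_G : Metric M n) (ω : M.X → M.F) (x y : M.X) : M.F :=
  M.act x (ω y) - M.act y (ω x) - ω (M.bracket x y)

def Closed1 (ω : M.X → M.F) : Prop := ∀ x y, G.d1 ω x y = 0

/-- gradient vector field of a function -/
def grad (f : M.F) : M.X := ∑ i, (G.eps i * M.act (G.e i) f) • G.e i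

/-- vector field associated to a 1-form -/
def sharp (ω : M.X → M.F) : M.X := ∑ i, (G.eps i * ω (G.e i)) • G.e i

/-- `x` is an eigenvector field of `T` with eigenvalue function `ρ` -/
def IsEigen (T : M.X → M.X → M.F) (ρ : M.F) (x : M.X) : Prop := ∀ z, T x z = ρ * G.g x z

/-- orthogonal projector onto a (regular) distribution -/
def IsProjector (v : M.X → M.X) : Prop :=
  (∀ (f : M.F) x, v (f • x) = f • v x) ∧ (∀ x y, v (x + y) = v x + v y) ∧
    (∀ x, v (v x) = v x) ∧ (∀ x y, G.g (v x) y = G.g x (v y))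

/-- trace of a projector (= dimension of the distribution) -/
def ptrace (v : M.X → M.X) : M.F := ∑ i, G.eps i * G.g (v (G.e i)) (G.e i)

/-- the complementary (orthogonal) projector -/
def co (_G : Metric M n) (v : M.X → M.X) (x : M.X) : M.X := x - v x

/-- generalized second fundamental form `Q_v(x,y) = h(∇_{v(x)} v(y))` -/
def Qv (v : M.X → M.X) (x y : M.X) : M.X := G.co v (G.conn (v x) (v y))

/-- umbilical distribution with `S_v = ½ v ⊗ a` -/
def UmbilicalWith (v : M.X → M.X) (a : M.X) : Prop :=
  ∀ x y, G.Qv v x y + G.Qv v y x = G.g (v x) (v y) • a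

/-- umbilical distribution of dimension `p` : `S_v = (1/p) v ⊗ Tr S_v` -/
def Umbilical (v : M.X → M.X) (p : ℕ) : Prop :=
  ∀ x y, (p : M.F) • (G.Qv v x y + G.Qv v y x)
    = (2 * G.g (v x) (v y)) • ∑ i, G.eps i • G.Qv v (G.e i) (G.e i)

/-- (totally) geodesic distribution: `S_v = 0` -/
def Geodesic (v : M.X → M.X) : Prop := ∀ x y, G.Qv v x y + G.Qv v y x = 0

/-- the symmetric 2-tensor `α v + β h` of an almost-product structure -/
def apTensor (v : M.X → M.X) (α β : M.F) (x y : M.X) : M.F :=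
  α * G.g (v x) y + β * G.g (x - v x) y

/-- projector on the line spanned by the unitary (`g(u,u) = ε = ±1`) field `u` -/
def uproj (u : M.X) (ε : M.F) (x : M.X) : M.X := (ε * G.g u x) • u

/-- acceleration `u̇ = ∇_u u` -/
def acc (u : M.X) : M.X := G.conn u u

/-- expansion `θ = ∇·u` -/
def expan (u : M.X) : M.F := ∑ i, G.eps i * G.g (G.conn (G.e i) u) (G.e i)

/-- vanishing of the shear `σ` of a unitary vector field `u` -/
def ShearFree (u : M.X) (ε : M.F) : Prop := ∀ x y,
  G.g (G.conn (G.co (G.uproj u ε) x) u) (G.co (G.uproj u ε) y)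
      + G.g (G.conn (G.co (G.uproj u ε) y) u) (G.co (G.uproj u ε) x)
    = algebraMap ℝ M.F (2 / ((n : ℝ) - 1)) * G.expan u
        * G.g (G.co (G.uproj u ε) x) (G.co (G.uproj u ε) y)

/-- condition (i) of Proposition 1: on each eigenspace,
`(T - ρ g){x,y} = g(x,y)(dρ - t)` -/
def CondI (T : M.X → M.X → M.F) (t : M.X → M.F) : Prop :=
  ∀ (ρ : M.F) (x y : M.X), G.IsEigen T ρ x → G.IsEigen T ρ y → ∀ z,
    T (G.sb x y) z - ρ * G.g (G.sb x y) z = G.g x y * (M.act z ρ - t z)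

/-- condition (ii) of Proposition 1 (condition (iii) of Theorem 1):
for eigenvectors with pairwise different eigenvalues,
`T(x,{y,z}) + T(z,{x,y}) + T(y,{z,x}) = 0` -/
def CondIII (T : M.X → M.X → M.F) : Prop :=
  ∀ (ρ₁ ρ₂ ρ₃ : M.F) (x y z : M.X),
    G.IsEigen T ρ₁ x → G.IsEigen T ρ₂ y → G.IsEigen T ρ₃ z →
    IsUnit (ρ₁ - ρ₂) → IsUnit (ρ₂ - ρ₃) → IsUnit (ρ₁ - ρ₃) →
    T x (G.sb y z) + T z (G.sb x y) + T y (G.sb z x) = 0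

/- Curvature -/

def curv (x y z : M.X) : M.X :=
  G.conn x (G.conn y z) - G.conn y (G.conn x z) - G.conn (M.bracket x y) z

def riem (x y z w : M.X) : M.F := G.g (G.curv x y z) w

def ricci (x y : M.X) : M.F := ∑ i, G.eps i * G.riem (G.e i) x y (G.e i)

def scal : M.F := ∑ i, G.eps i * G.ricci (G.e i) (G.e i)

/-- covariant derivative of a 4-tensor -/
def nabla4 (T : M.X → M.X → M.X → M.X → M.F) (x a b c d : M.X) : M.F :=
  M.act x (T a b c d) - T (G.conn x a) b c d - T a (G.conn x b) c d
    - T a b (G.conn x c) d - T a b c (G.conn x d)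

/- Dimension four: Hodge duality, self-dual formalism, Weyl tensor -/

/-- composition (`Tr₂₃`-contraction) of two 2-tensors -/
def comp2 (A B : M.X → M.X → M.F) (x y : M.X) : M.F :=
  ∑ i, G.eps i * A x (G.e i) * B (G.e i) y

end Metric

namespace Metric

variable {M : Man} (G : Metric M 4)

/-- the metric volume element `η` -/
def vol (x0 x1 x2 x3 : M.X) : M.F :=
  ((Matrix.of fun i j => G.eps j * G.g (![x0, x1, x2, x3] i) (G.e j)) :
    Matrix (Fin 4) (Fin 4) M.F).det

/-- Hodge dual of a 2-form -/
def hodge (U : M.X → M.X → M.F) (x y : M.X) : M.F :=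
  algebraMap ℝ M.F (1 / 2) *
    ∑ i, ∑ j, G.eps i * G.eps j * G.vol x y (G.e i) (G.e j) * U (G.e i) (G.e j)

/-- exterior codifferential of a 2-form -/
def codiff2 (U : M.X → M.X → M.F) (z : M.X) : M.F :=
  -∑ i, G.eps i * G.nabla2 U (G.e i) (G.e i) z

/-- the 1-form `i(δU)U` -/
def iD (U : M.X → M.X → M.F) (z : M.X) : M.F := U (G.sharp (G.codiff2 U)) z

/-- `Φ[U] = i(δU)U - i(δ*U)*U` -/
def Phi (U : M.X → M.X → M.F) (z : M.X) : M.F := G.iD U z - G.iD (G.hodge U) z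

/-- the self-dual unitary 2-form `𝒰 = (1/√2)(U - i *U)` -/
def sdU (U : M.X → M.X → M.F) (x y : M.X) : M.F × M.F :=
  (algebraMap ℝ M.F (Real.sqrt 2)⁻¹ * U x y,
    -(algebraMap ℝ M.F (Real.sqrt 2)⁻¹ * G.hodge U x y))

/-- the self-dual metric `𝒢 = ½(G - i η)` -/
def sdG (a b c d : M.X) : M.F × M.F :=
  (algebraMap ℝ M.F (1 / 2) * (G.g a c * G.g b d - G.g a d * G.g b c),
    -(algebraMap ℝ M.F (1 / 2) * G.vol a b c d))

/-- covariant derivative of a complex 2-tensor -/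
def nabla2C (T : M.X → M.X → M.F × M.F) (x y z : M.X) : M.F × M.F :=
  M.cxAct x (T y z) - T (G.conn x y) z - T y (G.conn x z)

/-- codifferential of a complex 2-form -/
def codiff2C (T : M.X → M.X → M.F × M.F) (z : M.X) : M.F × M.F :=
  -∑ i, cxSmul (G.eps i) (G.nabla2C T (G.e i) (G.e i) z)

/-- the (complex) vector field associated with a complex 1-form -/
def sharpC (ω : M.X → M.F × M.F) : M.X × M.X :=
  (G.sharp fun z => (ω z).1, G.sharp fun z => (ω z).2)

/-- evaluation of a complex 2-form on a complex vector (first slot) -/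
def evalC (_G : Metric M 4) (T : M.X → M.X → M.F × M.F) (ξ : M.X × M.X) (z : M.X) : M.F × M.F :=
  T ξ.1 z + cxMul cxI (T ξ.2 z)

/-- interior product of a complex vector with a complex 4-tensor (first slot) -/
def evalC4 (_G : Metric M 4) (A : M.X → M.X → M.X → M.X → M.F × M.F) (ξ : M.X × M.X) (x y z : M.X) :
    M.F × M.F :=
  A ξ.1 x y z + cxMul cxI (A ξ.2 x y z)

/-- `Σ[U] ≡ ∇𝒰 - i(δ𝒰)𝒰 ⊗ 𝒰 - i(δ𝒰)𝒢 = 0` (the umbilical condition) -/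
def SigmaCond (U : M.X → M.X → M.F) : Prop :=
  ∀ x y z, G.nabla2C (G.sdU U) x y z
    = cxMul (G.evalC (G.sdU U) (G.sharpC (G.codiff2C (G.sdU U))) x) (G.sdU U y z)
        + G.evalC4 G.sdG (G.sharpC (G.codiff2C (G.sdU U))) x y z

/-- the Weyl tensor (dimension four) -/
def weyl (a b c d : M.X) : M.F :=
  G.riem a b c d
    - algebraMap ℝ M.F (1 / 2) * (G.g a c * G.ricci b d + G.g b d * G.ricci a c
        - G.g a d * G.ricci b c - G.g b c * G.ricci a d)
    + algebraMap ℝ M.F (1 / 6) * G.scal * (G.g a c * G.g b d - G.g a d * G.g b c)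

/-- Hodge dual of a double 2-form on its first pair of indices -/
def hodgeL (T : M.X → M.X → M.X → M.X → M.F) (a b c d : M.X) : M.F :=
  algebraMap ℝ M.F (1 / 2) *
    ∑ i, ∑ j, G.eps i * G.eps j * G.vol a b (G.e i) (G.e j) * T (G.e i) (G.e j) c d

/-- the self-dual Weyl tensor `𝒲 = ½(W - i *W)` -/
def cWeyl (a b c d : M.X) : M.F × M.F :=
  (algebraMap ℝ M.F (1 / 2) * G.weyl a b c d,
    -(algebraMap ℝ M.F (1 / 2) * G.hodgeL G.weyl a b c d))

/-- composition of complex double 2-forms (as endomorphisms of bivectors) -/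
def compW (A B : M.X → M.X → M.X → M.X → M.F × M.F) (a b c d : M.X) : M.F × M.F :=
  cxSmul (algebraMap ℝ M.F (1 / 2))
    (∑ i, ∑ j, cxSmul (G.eps i * G.eps j)
      (cxMul (A a b (G.e i) (G.e j)) (B (G.e i) (G.e j) c d)))

/-- trace of a complex double 2-form (as an endomorphism of bivectors) -/
def trW (A : M.X → M.X → M.X → M.X → M.F × M.F) : M.F × M.F :=
  cxSmul (algebraMap ℝ M.F (1 / 2))
    (∑ i, ∑ j, cxSmul (G.eps i * G.eps j) (A (G.e i) (G.e j) (G.e i) (G.e j)))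

/-- the double Weyl eigenvalue `ρ = -Tr 𝒲³ / Tr 𝒲²` -/
def rhoWeyl : M.F × M.F :=
  -(cxMul (cxInv (G.trW (G.compW G.cWeyl G.cWeyl)))
      (G.trW (G.compW (G.compW G.cWeyl G.cWeyl) G.cWeyl)))

/-- the concomitant `𝒮 = (1/(3ρ))(𝒲 - ρ 𝒢)` -/
def sWeyl (a b c d : M.X) : M.F × M.F :=
  cxMul (cxInv (cxSmul 3 G.rhoWeyl)) (G.cWeyl a b c d - cxMul G.rhoWeyl (G.sdG a b c d))

/-- divergence-free Weyl tensor (vanishing Cotton tensor): `δW = 0` -/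
def DivFreeWeyl : Prop :=
  ∀ b c d, ∑ i, G.eps i * G.nabla4 G.weyl (G.e i) (G.e i) b c d = 0

/-- the bivector image `A(X)` of a bivector by a double 2-form -/
def sContract (A : M.X → M.X → M.X → M.X → M.F × M.F) (Xb : M.X → M.X → M.F × M.F)
    (x y : M.X) : M.F × M.F :=
  cxSmul (algebraMap ℝ M.F (1 / 2))
    (∑ i, ∑ j, cxSmul (G.eps i * G.eps j)
      (cxMul (A x y (G.e i) (G.e j)) (Xb (G.e i) (G.e j))))

/-- the scalar `A(X,X)` -/
def sNorm (A : M.X → M.X → M.X → M.X → M.F × M.F) (Xb : M.X → M.X → M.F × M.F) :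
    M.F × M.F :=
  cxSmul (algebraMap ℝ M.F (1 / 2))
    (∑ i, ∑ j, cxSmul (G.eps i * G.eps j)
      (cxMul (G.sContract A Xb (G.e i) (G.e j)) (Xb (G.e i) (G.e j))))

/-- self-dual complex bivector: `*𝒳 = i 𝒳` -/
def SelfDualC (Xb : M.X → M.X → M.F × M.F) : Prop :=
  ∀ x y, ((G.hodge fun a b => (Xb a b).1) x y, (G.hodge fun a b => (Xb a b).2) x y)
    = cxMul cxI (Xb x y)

/-- Lorentzian signature (-+++) -/
def Lorentz : Prop := G.eps 0 = -1 ∧ G.eps 1 = 1 ∧ G.eps 2 = 1 ∧ G.eps 3 = 1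

end Metric


/-- for two eigenvector fields of a solution of the conformal equation
with the same eigenvalue, `(T - ρ g){x,y} = g(x,y) s + g(s,x) y + g(s,y) x`
where `s = dρ - t`. -/
theorem stmt_2 {M : Man} {n : ℕ} (G : Metric M n) (T : M.X → M.X → M.F)
    (t : M.X → M.F) (hT : G.IsConformalWith T t) (ρ : M.F) (x y : M.X)
    (hx : G.IsEigen T ρ x) (hy : G.IsEigen T ρ y) :
    ∀ z, T (G.sb x y) z - ρ * G.g (G.sb x y) z
      = G.g x y * (M.act z ρ - t z) + (M.act x ρ - t x) * G.g y z
        + (M.act y ρ - t y) * G.g x z := by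
  intro z
  obtain ⟨⟨-, hadd, -, -⟩, hsymm, hconf⟩ := hT
  have h := hconf x y z
  simp only [Metric.killingOp, Metric.nabla2, Metric.symG] at h
  rw [hsymm z x, hsymm (G.conn y z) x, hsymm z (G.conn y x), hsymm (G.conn z x) y,
    hx z, hx y, hx (G.conn y z), hx (G.conn z y), hy z, hy (G.conn x z), hy (G.conn z x)] at h
  simp only [M.act_mulf, G.metric_compat] at h
  simp only [Metric.sb, hadd, G.g_addl]
  rw [G.g_symm z x, G.g_symm y (G.conn z x)] at h
  linear_combination -h

end KCT
end
end

section
/- Let T be a symmetric 2-tensor on a (pseudo-)Riemannian manifold (M,g) satisfying the conformal equation (in particular, a Killing or conformal tensor). If x, y, z are eigenvector fields of T corresponding to three pairwise different eigenvalue functions, then T(x, {y,z}) + T(z, {x,y}) + T(y, {z,x}) = 0, where {x,y} = ∇_x y + ∇_y x. -/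
/- An algebraic model of the differential geometry of an n-dimensional
(pseudo-)Riemannian manifold: `F` models the ring of smooth real functions,
`X` the `F`-module of vector fields, `act` the action of vector fields on
functions by derivation, `bracket` the Lie bracket, `g` the metric, `conn`
the Levi-Civita connection and `e`, `eps` a (pseudo-)orthonormal frame
recording the dimension and the signature. -/

noncomputable section

namespace KCT

theorem Man.act_zero (M : Man) (x : M.X) : M.act x 0 = 0 := by
  simpa using M.act_addf x 0 0

namespace Metric

variable {M : Man} {n : ℕ} {G : Metric M n} {T : M.X → M.X → M.F}

/-- eigenvector fields with different eigenvalues are orthogonal -/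
theorem IsEigen.orthogonal (hT : G.Symm2 T) {ρ₁ ρ₂ : M.F} {x y : M.X}
    (hx : G.IsEigen T ρ₁ x) (hy : G.IsEigen T ρ₂ y) (h : IsUnit (ρ₁ - ρ₂)) :
    G.g x y = 0 := by
  rw [← h.mul_right_eq_zero]
  linear_combination hT x y - hx y + hy x + ρ₂ * G.g_symm y x

theorem IsEigen.apply_eq_zero (hT : G.Symm2 T) {ρ₁ ρ₂ : M.F} {x y : M.X}
    (hx : G.IsEigen T ρ₁ x) (hy : G.IsEigen T ρ₂ y) (h : IsUnit (ρ₁ - ρ₂)) :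
    T x y = 0 := by
  rw [hx y, hx.orthogonal hT hy h, mul_zero]

end Metric

/-- for three eigenvector fields of a solution of the conformal
equation with pairwise different eigenvalues,
`T(x,{y,z}) + T(z,{x,y}) + T(y,{z,x}) = 0`. -/
theorem stmt_3 {M : Man} {n : ℕ} (G : Metric M n) (T : M.X → M.X → M.F)
    (t : M.X → M.F) (hT : G.IsConformalWith T t) (ρ₁ ρ₂ ρ₃ : M.F) (x y z : M.X)
    (hx : G.IsEigen T ρ₁ x) (hy : G.IsEigen T ρ₂ y) (hz : G.IsEigen T ρ₃ z)
    (h12 : IsUnit (ρ₁ - ρ₂)) (h23 : IsUnit (ρ₂ - ρ₃)) (h13 : IsUnit (ρ₁ - ρ₃)) :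
    T x (G.sb y z) + T z (G.sb x y) + T y (G.sb z x) = 0 := by
  obtain ⟨⟨-, -, -, hadd⟩, hsymm, hconf⟩ := hT
  have h31 : IsUnit (ρ₃ - ρ₁) := by simpa using h13.neg
  have key := hconf x y z
  simp only [Metric.killingOp, Metric.nabla2, Metric.symG,
    hx.orthogonal hsymm hy h12, hy.orthogonal hsymm hz h23, hz.orthogonal hsymm hx h31,
    hx.apply_eq_zero hsymm hy h12, hy.apply_eq_zero hsymm hz h23,
    hz.apply_eq_zero hsymm hx h31, M.act_zero] at key
  simp only [Metric.sb, hadd]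
  linear_combination -key - hsymm (G.conn x y) z - hsymm (G.conn y z) x
    - hsymm (G.conn z x) y

end KCT
end
end

section
/- Let E_ρ be a regular eigenspace (the restriction of g to E_ρ is nondegenerate) of a Killing tensor (respectively, a conformal tensor) T on a (pseudo-)Riemannian manifold (M,g), with eigenvalue function ρ. Then (T − ρ g){x,y} = g(x,y)(dρ − t) holds for every x, y in E_ρ (including null eigenvectors), where t = 0 for a Killing tensor and t = (2/(n+2)) ∇·T for a conformal tensor. Moreover dρ belongs to E_ρ^⊥ (respectively, 2∇·T − (n+2) dρ belongs to E_ρ^⊥). -/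
/- An algebraic model of the differential geometry of an n-dimensional
(pseudo-)Riemannian manifold: `F` models the ring of smooth real functions,
`X` the `F`-module of vector fields, `act` the action of vector fields on
functions by derivation, `bracket` the Lie bracket, `g` the metric, `conn`
the Levi-Civita connection and `e`, `eps` a (pseudo-)orthonormal frame
recording the dimension and the signature. -/

noncomputable section

namespace KCT

/-- The product of an `(n + 1) × n` and an `n × (n + 1)` matrix is singular. -/
theorem det_mul_eq_zero_of_succ {R : Type*} [CommRing R] {n : ℕ}
    (A : Matrix (Fin (n + 1)) (Fin n) R) (B : Matrix (Fin n) (Fin (n + 1)) R) :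
    (A * B).det = 0 := by
  have h : A * B = (Matrix.of fun i => Fin.cons 0 (A i)) *
      (Matrix.of (Fin.cons 0 B : Fin (n + 1) → Fin (n + 1) → R)) := by
    ext i j
    simp [Matrix.mul_apply, Fin.sum_univ_succ]
    rfl
  rw [h, Matrix.det_mul, Matrix.det_eq_zero_of_column_eq_zero 0 (by simp), zero_mul]

/-- Expansion of a determinant along its first row and its first column. -/
theorem det_eq_sub_sum_adjugate {R : Type*} [CommRing R] {n : ℕ}
    (A : Matrix (Fin (n + 1)) (Fin (n + 1)) R) :
    A.det = A 0 0 * (A.submatrix Fin.succ Fin.succ).det -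
      ∑ k : Fin n, ∑ i : Fin n, A i.succ 0 * A 0 k.succ *
        (A.submatrix Fin.succ Fin.succ).adjugate k i := by
  cases n with
  | zero => simp
  | succ n =>
    rw [Matrix.det_succ_row_zero, Fin.sum_univ_succ, sub_eq_add_neg, ← Finset.sum_neg_distrib]
    congr 1
    · simp [Fin.succAbove_zero]
    · refine Finset.sum_congr rfl fun k _ => ?_
      rw [Matrix.det_succ_column_zero, Finset.mul_sum, ← Finset.sum_neg_distrib]
      refine Finset.sum_congr rfl fun i _ => ?_
      have hs : (A.submatrix Fin.succ k.succ.succAbove).submatrix i.succAbove Fin.succ =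
          (A.submatrix Fin.succ Fin.succ).submatrix i.succAbove k.succAbove := by
        ext a c
        simp
      rw [Matrix.adjugate_fin_succ_eq_det_submatrix, hs]
      simp only [Matrix.submatrix_apply, Fin.succ_succAbove_zero, Fin.val_succ]
      ring

/-- If `2 A i j A j k = -A j j A i k` up to multiplication by `a`, then `det A` is, up to
multiplication by `a`, a nonzero multiple of the product of the diagonal entries. -/
theorem exists_mul_det_eq_mul_prod_diag {R : Type*} [CommRing R] [Algebra ℝ R] (a : R) {n : ℕ}
    (A : Matrix (Fin n) (Fin n) R)
    (h : ∀ i j k, 2 * (a * (A i j * A j k)) + a * (A j j * A i k) = 0) :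
    ∃ c : ℝ, c ≠ 0 ∧ a * A.det = algebraMap ℝ R c * (a * ∏ i, A i i) := by
  induction n with
  | zero => exact ⟨1, one_ne_zero, by simp⟩
  | succ n ih =>
    obtain ⟨c, hc, hdet⟩ := ih (A.submatrix Fin.succ Fin.succ) fun i j k => h _ _ _
    set B := A.submatrix Fin.succ Fin.succ with hB
    have htr : ∑ k : Fin n, ∑ i : Fin n, B i k * B.adjugate k i = n * B.det := by
      rw [Finset.sum_comm]
      calc _ = (B * B.adjugate).trace := by simp [Matrix.trace, Matrix.mul_apply]
        _ = n * B.det := by simp [Matrix.mul_adjugate, mul_comm]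
    have hsum : 2 * (a * ∑ k : Fin n, ∑ i : Fin n, A i.succ 0 * A 0 k.succ * B.adjugate k i) +
        a * (A 0 0 * (n * B.det)) = 0 := by
      rw [← htr]
      simp only [Finset.mul_sum, ← Finset.sum_add_distrib]
      refine Finset.sum_eq_zero fun k _ => Finset.sum_eq_zero fun i _ => ?_
      have hik : B i k = A i.succ k.succ := rfl
      rw [hik]
      linear_combination B.adjugate k i * h i.succ 0 k.succ
    refine ⟨(n + 2) / 2 * c, by positivity, ?_⟩
    have h2 : algebraMap ℝ R 2⁻¹ * 2 = 1 := by
      rw [← map_ofNat (algebraMap ℝ R) 2, ← map_mul]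
      norm_num
    have hn : algebraMap ℝ R ((n + 2) / 2 * c) =
        algebraMap ℝ R 2⁻¹ * (n + 2) * algebraMap ℝ R c := by
      rw [div_eq_mul_inv, mul_comm ((n : ℝ) + 2)]
      simp only [map_mul, map_add, map_natCast, map_ofNat]
    have hp : ∏ i, A i i = A 0 0 * ∏ i, B i i := Fin.prod_univ_succ _
    rw [hn, hp]
    have hexp := det_eq_sub_sum_adjugate A
    rw [← hB] at hexp
    rw [hexp]
    linear_combination (-algebraMap ℝ R 2⁻¹) * hsum +
      algebraMap ℝ R 2⁻¹ * (n + 2) * A 0 0 * hdet +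
      (a * (∑ k : Fin n, ∑ i : Fin n, A i.succ 0 * A 0 k.succ * B.adjugate k i) -
        a * A 0 0 * B.det) * h2

/-- McCoy's theorem for square matrices: if `a ≠ 0` annihilates the determinant of `A`, then
`A` is not injective on the multiples of `a`. -/
theorem exists_smul_mulVec_eq_zero {R : Type*} [CommRing R] {n : ℕ}
    (A : Matrix (Fin n) (Fin n) R) {a : R} (ha : a ≠ 0) (hdet : a * A.det = 0) :
    ∃ v : Fin n → R, a • v ≠ 0 ∧ A.mulVec (a • v) = 0 := by
  classical
  let P : ℕ → Prop := fun k => ∀ r c : Fin k → Fin n, a * (A.submatrix r c).det = 0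
  have hPn : P n := by
    intro r c
    by_cases hr : Function.Injective r
    · by_cases hc : Function.Injective c
      · let σ := Equiv.ofBijective r (Finite.injective_iff_bijective.mp hr)
        let τ := Equiv.ofBijective c (Finite.injective_iff_bijective.mp hc)
        have h : A.submatrix r c = (A.submatrix σ id).submatrix id τ := rfl
        rw [h, Matrix.det_permute', Matrix.det_permute]
        linear_combination ((Equiv.Perm.sign τ : ℤ) : R) * ((Equiv.Perm.sign σ : ℤ) : R) * hdet
      · obtain ⟨i, j, hij, hne⟩ := Function.not_injective_iff.mp hc
        rw [Matrix.det_zero_of_column_eq hne (by simp [hij]), mul_zero]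
    · obtain ⟨i, j, hij, hne⟩ := Function.not_injective_iff.mp hr
      rw [Matrix.det_zero_of_row_eq hne (by ext; simp [hij]), mul_zero]
  have hex : ∃ k, P k := ⟨n, hPn⟩
  obtain ⟨k, hk⟩ : ∃ k, Nat.find hex = k + 1 := by
    refine Nat.exists_eq_succ_of_ne_zero fun h0 => ha ?_
    have h := (Nat.find_eq_zero hex).mp h0 Fin.elim0 Fin.elim0
    simpa using h
  have hPk : P (k + 1) := hk ▸ Nat.find_spec hex
  have hkn : k < n := by
    have := Nat.find_min' hex hPn
    omega
  have hnot : ¬ P k := Nat.find_min hex (by omega)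
  simp only [P, not_forall] at hnot
  obtain ⟨r, c, hrc⟩ := hnot
  obtain ⟨j, hj⟩ : ∃ j, ∀ s, c s ≠ j := by
    by_contra! hcon
    have := Fintype.card_le_of_surjective c hcon
    simp only [Fintype.card_fin] at this
    omega
  let d : Fin (k + 1) → Fin n := Fin.cons j c
  let m : Fin (k + 1) → R := fun s => (-1) ^ (s : ℕ) * (A.submatrix r (d ∘ s.succAbove)).det
  refine ⟨∑ s, Pi.single (d s) (m s), fun h => hrc ?_, ?_⟩
  · have hjj := congrFun h j
    have hd : d ∘ Fin.succ = c := by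
      ext s
      simp [d]
    simpa [Fin.sum_univ_succ, Pi.single_apply, d, m, (hj _).symm, hd] using hjj
  · ext i
    have hi := hPk (Fin.cons i r) d
    have hrows (s : Fin (k + 1)) : (A.submatrix (Fin.cons i r : Fin (k + 1) → Fin n) d).submatrix
        Fin.succ s.succAbove = A.submatrix r (d ∘ s.succAbove) := by
      ext
      simp
    rw [Matrix.det_succ_row_zero] at hi
    simp only [hrows, Matrix.submatrix_apply, Fin.cons_zero] at hi
    rw [Matrix.mulVec_smul, Matrix.mulVec_sum, Pi.smul_apply, Finset.sum_apply, smul_eq_mul,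
      Pi.zero_apply, ← hi]
    congr 1
    refine Finset.sum_congr rfl fun s _ => ?_
    rw [Matrix.mulVec_single]
    simp only [m, Pi.smul_apply, Matrix.col_apply, MulOpposite.smul_eq_mul_unop,
      MulOpposite.unop_op]
    ring

/-- Let `g` be a symmetric bilinear form whose restriction to the kernel `E` of a bilinear form
`S` is nondegenerate. If the symmetrization of `ω ⊗ g` vanishes on `E`, then so does `ω`. -/
theorem eq_zero_of_symm_mul_eq_zero {R X : Type*} [CommRing R] [Algebra ℝ R] [AddCommGroup X]
    [Module R X] {n : ℕ} (b : Module.Basis (Fin n) R X) (g S : X →ₗ[R] X →ₗ[R] R)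
    (hg : ∀ x y, g x y = g y x)
    (hreg : ∀ x, S x = 0 → (∀ y, S y = 0 → g x y = 0) → x = 0) (ω : X →ₗ[R] R)
    (hω : ∀ x y z, S x = 0 → S y = 0 → S z = 0 →
      ω x * g y z + ω y * g z x + ω z * g x y = 0)
    {x : X} (hx : S x = 0) : ω x = 0 := by
  have cancel (r : ℝ) (hr : r ≠ 0) (c : R) (h : algebraMap ℝ R r * c = 0) : c = 0 :=
    ((hr.isUnit.map (algebraMap ℝ R)).mul_right_eq_zero).mp h
  have cancel2 (c : R) (h : 2 * c = 0) : c = 0 := 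
    cancel 2 two_ne_zero c (by rwa [map_ofNat])
  have expand (L : X →ₗ[R] X →ₗ[R] R) (u w : X) :
      ∑ i, b.equivFun u i * L (b i) w = L u w := by
    conv_rhs => rw [← b.sum_equivFun u]
    simp only [map_sum, map_smul, LinearMap.sum_apply, LinearMap.smul_apply, smul_eq_mul]
  -- a value of `ω` that annihilates `g` on the kernel is zero
  have core (x : X) (hx : S x = 0) (hq : ∀ y, S y = 0 → ω x * g y y = 0) : ω x = 0 := by
    by_contra hne
    have hg0 (y z : X) (hy : S y = 0) (hz : S z = 0) : ω x * g y z = 0 := by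
      refine cancel2 _ ?_
      have h := hq (y + z) (by simp [hy, hz])
      simp only [map_add, LinearMap.add_apply] at h
      linear_combination h - hq y hy - hq z hz - ω x * hg z y
    have hsmul (y : X) (hy : S y = 0) : ω x • y = 0 :=
      hreg _ (by simp [hy]) fun z hz => by simpa using hg0 y z hy hz
    let A : Matrix (Fin n) (Fin n) R := Matrix.of fun j i => S (b i) (b j)
    have hA (u : X) : A.mulVec (b.equivFun u) = fun j => S u (b j) := by
      ext j
      rw [← expand]
      simp only [A, Matrix.mulVec, dotProduct, Matrix.of_apply, mul_comm]
    have hdet : A.det • x = 0 := by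
      apply b.equivFun.injective
      have h0 : A.mulVec (b.equivFun x) = 0 := by
        rw [hA, hx]
        rfl
      have h := congrArg A.adjugate.mulVec h0
      rw [Matrix.mulVec_mulVec, Matrix.adjugate_mul, Matrix.smul_mulVec, Matrix.one_mulVec,
        Matrix.mulVec_zero] at h
      rw [map_smul, map_zero, h]
    have hωdet : ω x * A.det = 0 := by
      rw [mul_comm, ← smul_eq_mul, ← map_smul, hdet, map_zero]
    obtain ⟨v, hv, hAv⟩ := exists_smul_mulVec_eq_zero A hne hωdet
    have hSv : S (ω x • b.equivFun.symm v) = 0 := by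
      refine b.ext fun j => ?_
      have h := congrFun (hA (ω x • b.equivFun.symm v)) j
      rw [map_smul, LinearEquiv.apply_symm_apply, hAv] at h
      simpa using h.symm
    refine hv ?_
    have h0 : ω x • b.equivFun.symm v = 0 := hreg _ hSv fun y hy => by
      rw [map_smul, LinearMap.smul_apply, ← map_smul, hsmul y hy, map_zero]
    rw [← map_smul] at h0
    exact (LinearEquiv.map_eq_zero_iff _).mp h0
  have contract (x y z w : X) (hx : S x = 0) (hy : S y = 0) (hz : S z = 0) (hw : S w = 0) :
      2 * (ω x * (g y z * g z w)) + ω x * (g z z * g y w) = 0 := by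
    refine cancel2 _ ?_
    have e1 := hω x y z hx hy hz
    have e2 := hω x y w hx hy hw
    have e3 := hω x z z hx hz hz
    have e4 := hω x z w hx hz hw
    have e5 := hω z z w hz hz hw
    have e6 := hω y z w hy hz hw
    have e7 := hω y z z hy hz hz
    rw [hg z x] at e1 e3
    rw [hg w x] at e2 e4
    rw [hg w z] at e5
    rw [hg w y] at e6
    rw [hg z y] at e7
    linear_combination 2 * g z w * e1 + g z z * e2 + g y w * e3 + 2 * g y z * e4
      - g x y * e5 - 2 * g x z * e6 - g x w * e7
  have gram (x : X) (hx : S x = 0) (y : Fin (n + 1) → X) (hy : ∀ i, S (y i) = 0) :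
      ω x * ∏ i, g (y i) (y i) = 0 := by
    let A : Matrix (Fin (n + 1)) (Fin (n + 1)) R := Matrix.of fun i j => g (y i) (y j)
    have hA : A.det = 0 := by
      have h : A = (Matrix.of fun i k => b.equivFun (y i) k) *
          (Matrix.of fun k j => g (b k) (y j)) := by
        ext i j
        exact (expand g (y i) (y j)).symm
      rw [h, det_mul_eq_zero_of_succ]
    obtain ⟨c, hc, h⟩ := exists_mul_det_eq_mul_prod_diag (ω x) A fun i j k =>
      contract x _ _ _ hx (hy i) (hy j) (hy k)
    rw [hA, mul_zero] at h
    exact cancel c hc _ h.symm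
  have descend (k : ℕ) : (∀ x, S x = 0 → ∀ y : Fin k → X, (∀ i, S (y i) = 0) →
      ω x * ∏ i, g (y i) (y i) = 0) → ∀ x, S x = 0 → ω x = 0 := by
    induction k with
    | zero => exact fun h x hx => by simpa using h x hx Fin.elim0 fun i => i.elim0
    | succ k ih =>
      refine fun h => ih fun x hx y hy => ?_
      have hmul : ω ((∏ i, g (y i) (y i)) • x) = ω x * ∏ i, g (y i) (y i) := by
        rw [map_smul, smul_eq_mul, mul_comm]
      rw [← hmul]
      refine core _ (by simp [hx]) fun z hz => ?_
      have h' := h x hx (Fin.cons z y) (Fin.cases hz hy)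
      rw [Fin.prod_univ_succ] at h'
      simp only [Fin.cons_zero, Fin.cons_succ] at h'
      rw [hmul]
      linear_combination h'
  exact descend (n + 1) gram x hx

namespace Metric

variable {M : Man} {n : ℕ} (G : Metric M n)

theorem g_addr (x y z : M.X) : G.g x (y + z) = G.g x y + G.g x z := by
  rw [G.g_symm, G.g_addl, G.g_symm y, G.g_symm z]

theorem g_smulr (f : M.F) (x y : M.X) : G.g x (f • y) = f * G.g x y := by
  rw [G.g_symm, G.g_smull, G.g_symm y]

theorem bilin_g : G.Bilin G.g :=
  ⟨G.g_smull, G.g_addl, G.g_smulr, G.g_addr⟩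

/-- the coordinates of a vector field in the (pseudo-)orthonormal frame -/
def frameEquiv : M.X ≃ₗ[M.F] (Fin n → M.F) where
  toFun x i := G.eps i * G.g x (G.e i)
  invFun v := ∑ i, v i • G.e i
  map_add' x y := by
    ext i
    simp only [G.g_addl, Pi.add_apply]
    ring
  map_smul' f x := by
    ext i
    simp only [G.g_smull, Pi.smul_apply, RingHom.id_apply, smul_eq_mul]
    ring
  left_inv x := (G.frame_complete x).symm
  right_inv v := by
    ext i
    have hsum : G.g (∑ j, v j • G.e j) (G.e i) = ∑ j, v j * G.g (G.e j) (G.e i) := by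
      let φ : M.X →+ M.F := AddMonoidHom.mk' (fun x => G.g x (G.e i)) fun x y => G.g_addl x y _
      refine (map_sum φ _ _).trans (Finset.sum_congr rfl fun j _ => G.g_smull _ _ _)
    have heps : G.eps i * G.eps i = 1 := by
      rcases G.eps_pm i with h | h <;> simp [h]
    change G.eps i * G.g (∑ j, v j • G.e j) (G.e i) = v i
    rw [hsum]
    simp only [G.frame_on, mul_ite, mul_zero, Finset.sum_ite_eq', Finset.mem_univ, if_true]
    linear_combination v i * heps

variable {G}

/-- a 2-tensor as a bilinear map -/
def Bilin.toLin {T : M.X → M.X → M.F} (hT : G.Bilin T) : M.X →ₗ[M.F] M.X →ₗ[M.F] M.F :=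
  LinearMap.mk₂ M.F T hT.2.1 hT.1 hT.2.2.2 hT.2.2.1

theorem Bilin.toLin_apply {T : M.X → M.X → M.F} (hT : G.Bilin T) (x y : M.X) :
    hT.toLin x y = T x y := rfl

theorem isEigen_iff {T : M.X → M.X → M.F} (hT : G.Bilin T) (ρ : M.F) (x : M.X) :
    G.IsEigen T ρ x ↔ (hT.toLin - ρ • G.bilin_g.toLin) x = 0 := by
  simp [IsEigen, LinearMap.ext_iff, Bilin.toLin_apply, sub_eq_zero]

theorem div2_add {T : M.X → M.X → M.F} (hT : G.Bilin T) (x y : M.X) :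
    G.div2 T (x + y) = G.div2 T x + G.div2 T y := by
  simp only [div2, ← Finset.sum_add_distrib]
  refine Finset.sum_congr rfl fun i _ => ?_
  simp only [nabla2, G.conn_addr, hT.2.2.2, M.act_addf]
  ring

theorem div2_smul {T : M.X → M.X → M.F} (hT : G.Bilin T) (f : M.F) (x : M.X) :
    G.div2 T (f • x) = f * G.div2 T x := by
  simp only [div2, Finset.mul_sum]
  refine Finset.sum_congr rfl fun i _ => ?_
  simp only [nabla2, G.conn_leibniz, hT.2.2.2, hT.2.2.1, M.act_mulf]
  ring

/-- the conformal equation evaluated on two eigenvectors and an arbitrary vector -/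
theorem IsConformalWith.sb_eigen {T : M.X → M.X → M.F} {t : M.X → M.F}
    (h : G.IsConformalWith T t) {ρ : M.F} {x y : M.X} (hx : G.IsEigen T ρ x)
    (hy : G.IsEigen T ρ y) (z : M.X) :
    T (G.sb x y) z - ρ * G.g (G.sb x y) z = G.g x y * (M.act z ρ - t z) +
      G.g y z * (M.act x ρ - t x) + G.g z x * (M.act y ρ - t y) := by
  obtain ⟨hT, hS, hK⟩ := h
  have hxyz := hK x y z
  simp only [killingOp, nabla2, symG] at hxyz
  rw [hy z, hS z x, hx z, hx y, M.act_mulf, M.act_mulf, M.act_mulf, G.metric_compat,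
    G.metric_compat, G.metric_compat, hy, hS z (G.conn y x), hS (G.conn y z) x, hx,
    hS (G.conn z x) y, hy, hx] at hxyz
  simp only [sb, hT.2.1, G.g_addl]
  linear_combination M.act y ρ * G.g_symm x z + ρ * G.g_symm (G.conn z x) y - hxyz

/-- `dρ - t` vanishes on a regular eigenspace with eigenvalue `ρ` -/
theorem IsConformalWith.act_eq {T : M.X → M.X → M.F} {t : M.X → M.F}
    (h : G.IsConformalWith T t) (ht_add : ∀ x y, t (x + y) = t x + t y)
    (ht_smul : ∀ (f : M.F) x, t (f • x) = f * t x) {ρ : M.F}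
    (hreg : ∀ x, G.IsEigen T ρ x → (∀ y, G.IsEigen T ρ y → G.g x y = 0) → x = 0)
    {x : M.X} (hx : G.IsEigen T ρ x) : M.act x ρ - t x = 0 := by
  let ω : M.X →ₗ[M.F] M.F :=
    { toFun := fun x => M.act x ρ - t x
      map_add' := fun x y => by
        rw [M.act_addv, ht_add]
        ring
      map_smul' := fun f x => by
        rw [M.act_smulv, ht_smul, RingHom.id_apply, smul_eq_mul]
        ring }
  simp only [isEigen_iff h.1] at hreg
  refine eq_zero_of_symm_mul_eq_zero (Module.Basis.ofEquivFun G.frameEquiv) G.bilin_g.toLin _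
    G.g_symm hreg ω (fun x y z hx hy hz => ?_) ((isEigen_iff h.1 ρ x).mp hx)
  rw [← isEigen_iff h.1] at hx hy hz
  have hxyz := h.sb_eigen hx hy z
  rw [h.2.1, hz, G.g_symm z, sub_self] at hxyz
  change (M.act x ρ - t x) * G.g y z + (M.act y ρ - t y) * G.g z x +
    (M.act z ρ - t z) * G.g x y = 0
  linear_combination -hxyz

theorem IsConformalWith.sb_eigen_of_regular {T : M.X → M.X → M.F} {t : M.X → M.F}
    (h : G.IsConformalWith T t) (ht_add : ∀ x y, t (x + y) = t x + t y)
    (ht_smul : ∀ (f : M.F) x, t (f • x) = f * t x) {ρ : M.F}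
    (hreg : ∀ x, G.IsEigen T ρ x → (∀ y, G.IsEigen T ρ y → G.g x y = 0) → x = 0)
    {x y : M.X} (hx : G.IsEigen T ρ x) (hy : G.IsEigen T ρ y) (z : M.X) :
    T (G.sb x y) z - ρ * G.g (G.sb x y) z = G.g x y * (M.act z ρ - t z) := by
  rw [h.sb_eigen hx hy, h.act_eq ht_add ht_smul hreg hx, h.act_eq ht_add ht_smul hreg hy]
  ring

end Metric

/-- on a regular eigenspace of a Killing (resp. conformal) tensor,
`(T - ρ g){x,y} = g(x,y)(dρ - t)` holds with `t = 0` (resp. `t = (2/(n+2))∇·T`),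
and `dρ ∈ E_ρ^⊥` (resp. `2∇·T - (n+2)dρ ∈ E_ρ^⊥`). -/
theorem stmt_4 {M : Man} {n : ℕ} (G : Metric M n) (T : M.X → M.X → M.F) (ρ : M.F)
    (hreg : ∀ x, G.IsEigen T ρ x → (∀ y, G.IsEigen T ρ y → G.g x y = 0) → x = 0) :
    (G.IsKilling T →
      (∀ x y, G.IsEigen T ρ x → G.IsEigen T ρ y → ∀ z,
        T (G.sb x y) z - ρ * G.g (G.sb x y) z = G.g x y * M.act z ρ) ∧
      (∀ x, G.IsEigen T ρ x → M.act x ρ = 0)) ∧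
    (G.IsConformal T →
      (∀ x y, G.IsEigen T ρ x → G.IsEigen T ρ y → ∀ z,
        T (G.sb x y) z - ρ * G.g (G.sb x y) z = G.g x y * (M.act z ρ - G.ct T z)) ∧
      (∀ x, G.IsEigen T ρ x → 2 * G.div2 T x - ((n : M.F) + 2) * M.act x ρ = 0)) := by
  constructor
  · intro h
    have h0 : G.IsConformalWith T fun _ => 0 :=
      ⟨h.1, h.2.1, fun x y z => by simp [h.2.2 x y z, Metric.symG]⟩
    refine ⟨fun x y hx hy z => ?_, fun x hx => ?_⟩
    · simpa using h0.sb_eigen_of_regular (by simp) (by simp) hreg hx hy z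
    · simpa using h0.act_eq (by simp) (by simp) hreg hx
  · intro h
    have ht_add (x y : M.X) : G.ct T (x + y) = G.ct T x + G.ct T y := by
      rw [Metric.ct, Metric.div2_add h.1, mul_add]
      rfl
    have ht_smul (f : M.F) (x : M.X) : G.ct T (f • x) = f * G.ct T x := by
      rw [Metric.ct, Metric.div2_smul h.1, mul_left_comm]
      rfl
    refine ⟨fun x y hx hy => h.sb_eigen_of_regular ht_add ht_smul hreg hx hy, fun x hx => ?_⟩
    have hω := h.act_eq ht_add ht_smul hreg hx
    have hn : ((n : M.F) + 2) * algebraMap ℝ M.F (2 / ((n : ℝ) + 2)) = 2 := by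
      have hn0 : (n : ℝ) + 2 ≠ 0 := by positivity
      have hcast : (n : M.F) + 2 = algebraMap ℝ M.F ((n : ℝ) + 2) := by
        rw [map_add, map_natCast, map_ofNat]
      rw [hcast, ← map_mul, mul_div_cancel₀ _ hn0, map_ofNat]
    rw [Metric.ct] at hω
    linear_combination (-((n : M.F) + 2)) * hω - G.div2 T x * hn

end KCT
end
end

section
/- Let (V,H) be a p+q almost-product structure on an n-dimensional (pseudo-)Riemannian manifold (n = p+q), with projectors v and h = g − v, and let α, β be functions. The symmetric 2-tensor K = α v + β h is a Killing tensor if, and only if: (i) the eigenstructure (V,H) is umbilical, i.e. the second fundamental forms can be written S_v = (1/2) v ⊗ a and S_h = (1/2) h ⊗ b; and (ii) the traces Tr S_v = (p/2) a and Tr S_h = (q/2) b and the eigenvalues are related by a = (1/(β − α)) dα and b = (1/(α − β)) dβ. -/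
/- An algebraic model of the differential geometry of an n-dimensional
(pseudo-)Riemannian manifold: `F` models the ring of smooth real functions,
`X` the `F`-module of vector fields, `act` the action of vector fields on
functions by derivation, `bracket` the Lie bracket, `g` the metric, `conn`
the Levi-Civita connection and `e`, `eps` a (pseudo-)orthonormal frame
recording the dimension and the signature. -/

noncomputable section

namespace KCT

namespace Man

variable (M : Man)

theorem act_zerof (x : M.X) : M.act x 0 = 0 := by
  simpa using M.act_const x 0

theorem act_zerov (f : M.F) : M.act 0 f = 0 := by
  simpa using M.act_smulv 0 0 f

theorem act_sumv {ι : Type} (s : Finset ι) (w : ι → M.X) (f : M.F) :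
    M.act (∑ i ∈ s, w i) f = ∑ i ∈ s, M.act (w i) f :=
  map_sum (⟨⟨fun x => M.act x f, M.act_zerov f⟩, fun x y => M.act_addv x y f⟩ : M.X →+ M.F) w s

theorem isUnit_natCast_add_two (k : ℕ) : IsUnit ((k : M.F) + 2) := by
  have h : IsUnit (algebraMap ℝ M.F ((k : ℝ) + 2)) :=
    (IsUnit.mk0 _ (by positivity)).map (algebraMap ℝ M.F)
  simpa only [map_add, map_natCast, map_ofNat] using h

end Man

namespace Metric

variable {M : Man} {n : ℕ} (G : Metric M n)

theorem g_zerol (x : M.X) : G.g 0 x = 0 := by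
  simpa using G.g_smull 0 0 x

theorem g_zeror (x : M.X) : G.g x 0 = 0 := by
  rw [G.g_symm, G.g_zerol]

theorem g_subl (x y z : M.X) : G.g (x - y) z = G.g x z - G.g y z := by
  rw [eq_sub_iff_add_eq, ← G.g_addl, sub_add_cancel]

theorem g_subr (x y z : M.X) : G.g x (y - z) = G.g x y - G.g x z := by
  rw [eq_sub_iff_add_eq, ← G.g_addr, sub_add_cancel]

theorem g_suml {ι : Type} (s : Finset ι) (w : ι → M.X) (z : M.X) :
    G.g (∑ i ∈ s, w i) z = ∑ i ∈ s, G.g (w i) z :=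
  map_sum (⟨⟨fun x => G.g x z, G.g_zerol z⟩, fun x y => G.g_addl x y z⟩ : M.X →+ M.F) w s

theorem g_nondegenerate {x y : M.X} (h : ∀ z, G.g x z = G.g y z) : x = y := by
  rw [G.frame_complete x, G.frame_complete y]
  simp only [h]

theorem act_eq_sum_frame (z : M.X) (f : M.F) :
    M.act z f = ∑ i, G.eps i * G.g z (G.e i) * M.act (G.e i) f := by
  conv_lhs => rw [G.frame_complete z]
  simp only [M.act_sumv, M.act_smulv]

theorem g_grad (f : M.F) (z : M.X) : G.g (G.grad f) z = M.act z f := by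
  rw [grad, G.g_suml, G.act_eq_sum_frame]
  refine Finset.sum_congr rfl fun i _ => ?_
  rw [G.g_smull, G.g_symm z]
  ring

theorem eps_mul_self (i : Fin n) : G.eps i * G.eps i = 1 := by
  rcases G.eps_pm i with h | h <;> simp [h]

theorem nabla2_symm {T : M.X → M.X → M.F} (hT : G.Symm2 T) (x y z : M.X) :
    G.nabla2 T x y z = G.nabla2 T x z y := by
  simp only [nabla2, hT y z, hT (G.conn x y) z, hT y (G.conn x z)]
  ring

theorem killingOp_cyclic (T : M.X → M.X → M.F) (x y z : M.X) :
    G.killingOp T x y z = G.killingOp T y z x := by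
  simp only [killingOp]
  ring

theorem killingOp_add {T : M.X → M.X → M.F} (hT : G.Bilin T) (x x' y z : M.X) :
    G.killingOp T (x + x') y z = G.killingOp T x y z + G.killingOp T x' y z := by
  obtain ⟨-, hl, -, hr⟩ := hT
  simp only [killingOp, nabla2, hl, hr, G.conn_addl, G.conn_addr, M.act_addv, M.act_addf]
  ring

variable {G} {v : M.X → M.X}

theorem IsProjector.map_sub (hv : G.IsProjector v) (x y : M.X) : v (x - y) = v x - v y := by
  rw [eq_sub_iff_add_eq, ← hv.2.1, sub_add_cancel]

theorem IsProjector.co (hv : G.IsProjector v) : G.IsProjector (G.co v) := by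
  refine ⟨fun f x => ?_, fun x y => ?_, fun x => ?_, fun x y => ?_⟩
  · simp only [Metric.co, hv.1, smul_sub]
  · simp only [Metric.co, hv.2.1]
    abel
  · simp only [Metric.co, hv.map_sub, hv.2.2.1, sub_self, sub_zero]
  · simp only [Metric.co, G.g_subl, G.g_subr, hv.2.2.2]

theorem IsProjector.apply_co (hv : G.IsProjector v) (x : M.X) : v (G.co v x) = 0 := by
  simp only [Metric.co, hv.map_sub, hv.2.2.1, sub_self]

theorem IsProjector.g_co (hv : G.IsProjector v) (x y : M.X) :
    G.g (G.co v x) y = G.g x (G.co v y) :=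
  hv.co.2.2.2 x y

theorem IsProjector.g_eq_zero (hv : G.IsProjector v) {x z : M.X} (hx : v x = x) (hz : v z = 0) :
    G.g x z = 0 := by
  rw [← hx, hv.2.2.2, hz, G.g_zeror]

theorem ptrace_co {p q : ℕ} (hpq : p + q = n) (hd : G.ptrace v = (p : M.F)) :
    G.ptrace (G.co v) = (q : M.F) := by
  have h : G.ptrace (G.co v) = ∑ i, G.eps i * G.g (G.e i) (G.e i) - G.ptrace v := by
    simp only [ptrace, Metric.co, G.g_subl, mul_sub, Finset.sum_sub_distrib]
  have h1 : ∑ i, G.eps i * G.g (G.e i) (G.e i) = (n : M.F) := by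
    simp [G.frame_on, G.eps_mul_self]
  rw [h, h1, hd, ← hpq]
  push_cast
  ring

theorem apTensor_co (α β : M.F) : G.apTensor (G.co v) β α = G.apTensor v α β := by
  funext x y
  simp only [apTensor, Metric.co, sub_sub_cancel]
  ring

theorem bilin_apTensor (hv : G.IsProjector v) (α β : M.F) : G.Bilin (G.apTensor v α β) := by
  refine ⟨fun f x y => ?_, fun x y z => ?_, fun f x y => ?_, fun x y z => ?_⟩ <;>
  · simp only [apTensor, hv.1, hv.2.1, G.g_subl, G.g_addl, G.g_addr, G.g_smull, G.g_smulr]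
    ring

theorem symm2_apTensor (hv : G.IsProjector v) (α β : M.F) : G.Symm2 (G.apTensor v α β) := by
  intro x y
  simp only [apTensor, G.g_subl, hv.2.2.2 x, G.g_symm x]

theorem apTensor_of_mem (hv : G.IsProjector v) (α β : M.F) {x : M.X} (hx : v x = x) (y : M.X) :
    G.apTensor v α β x y = α * G.g x y ∧ G.apTensor v α β y x = α * G.g x y := by
  rw [symm2_apTensor hv α β y x]
  simp [apTensor, hx, G.g_zerol]

theorem apTensor_of_orthogonal (hv : G.IsProjector v) (α β : M.F) {x : M.X} (hx : v x = 0)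
    (y : M.X) :
    G.apTensor v α β x y = β * G.g x y ∧ G.apTensor v α β y x = β * G.g x y := by
  rw [symm2_apTensor hv α β y x]
  simp [apTensor, hx, G.g_zerol]

theorem nabla2_apTensor_of_mem (hv : G.IsProjector v) (α β : M.F) {x y : M.X}
    (hx : v x = x) (hy : v y = y) (z : M.X) :
    G.nabla2 (G.apTensor v α β) z x y = M.act z α * G.g x y := by
  rw [nabla2, (apTensor_of_mem hv α β hx y).1, (apTensor_of_mem hv α β hy _).2,
    (apTensor_of_mem hv α β hx _).1, M.act_mulf, G.metric_compat, G.g_symm y]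
  ring

theorem nabla2_apTensor_mixed (hv : G.IsProjector v) (α β : M.F) {y z : M.X}
    (hy : v y = y) (hz : v z = 0) (x : M.X) :
    G.nabla2 (G.apTensor v α β) x y z = (α - β) * G.g (G.conn x y) z := by
  have h := G.metric_compat x y z
  rw [hv.g_eq_zero hy hz, M.act_zerof] at h
  rw [nabla2, (apTensor_of_mem hv α β hy z).1, (apTensor_of_orthogonal hv α β hz _).2,
    (apTensor_of_mem hv α β hy _).1, hv.g_eq_zero hy hz, mul_zero, M.act_zerof, G.g_symm z]
  linear_combination α * h

theorem killingOp_apTensor_of_mem (hv : G.IsProjector v) (α β : M.F) {x y z : M.X}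
    (hx : v x = x) (hy : v y = y) (hz : v z = z) :
    G.killingOp (G.apTensor v α β) x y z
      = M.act x α * G.g y z + M.act y α * G.g z x + M.act z α * G.g x y := by
  rw [killingOp, nabla2_apTensor_of_mem hv α β hy hz, nabla2_apTensor_of_mem hv α β hz hx,
    nabla2_apTensor_of_mem hv α β hx hy]

theorem killingOp_apTensor_mixed (hv : G.IsProjector v) (α β : M.F) {x y z : M.X}
    (hx : v x = x) (hy : v y = y) (hz : v z = 0) :
    G.killingOp (G.apTensor v α β) x y z
      = (α - β) * G.g (G.sb x y) z + M.act z α * G.g x y := by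
  rw [killingOp, nabla2_apTensor_mixed hv α β hy hz,
    G.nabla2_symm (symm2_apTensor hv α β) y z x, nabla2_apTensor_mixed hv α β hx hz,
    nabla2_apTensor_of_mem hv α β hx hy, sb, G.g_addl]
  ring

theorem g_Qv_add_Qv (hv : G.IsProjector v) (x y z : M.X) :
    G.g (G.Qv v x y + G.Qv v y x) z = G.g (G.sb (v x) (v y)) (G.co v z) := by
  rw [G.g_addl, Qv, Qv, hv.g_co, hv.g_co, ← G.g_addl, sb]

/-- An eigenvalue of a Killing tensor is constant along its eigenspace. -/
theorem act_eq_zero_of_killingOp (hv : G.IsProjector v) {p : ℕ} (hd : G.ptrace v = (p : M.F))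
    {α β : M.F}
    (h : ∀ x y z, v x = x → v y = y → v z = z → G.killingOp (G.apTensor v α β) x y z = 0)
    {z : M.X} (hz : v z = z) : M.act z α = 0 := by
  have hi (i : Fin n) : G.eps i * (2 * (M.act (v (G.e i)) α * G.g z (G.e i))
      + M.act z α * G.g (v (G.e i)) (G.e i)) = 0 := by
    have hvi := hv.2.2.1 (G.e i)
    have := h _ _ z hvi hvi hz
    rw [killingOp_apTensor_of_mem hv α β hvi hvi hz, G.g_symm _ z, ← hv.2.2.2 z, hz,
      ← hv.2.2.2 (v (G.e i)), hvi] at this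
    linear_combination G.eps i * this
  have hz' : ∑ i, G.eps i * (M.act (v (G.e i)) α * G.g z (G.e i)) = M.act z α := by
    have hsum : z = ∑ i, (G.eps i * G.g z (G.e i)) • v (G.e i) := by
      apply G.g_nondegenerate
      intro w
      conv_lhs => rw [← hz, hv.2.2.2, G.frame_complete z]
      simp only [G.g_suml, G.g_smull, hv.2.2.2]
    conv_rhs => rw [hsum]
    rw [M.act_sumv]
    refine Finset.sum_congr rfl fun i _ => ?_
    rw [M.act_smulv]
    ring
  have hs := Finset.sum_eq_zero (s := Finset.univ) fun i _ => hi i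
  have htot : ((p : M.F) + 2) * M.act z α = 0 := by
    rw [← hs, ← hd, add_mul, ← hz', ptrace, Finset.sum_mul, Finset.mul_sum,
      ← Finset.sum_add_distrib, hz']
    refine Finset.sum_congr rfl fun i _ => ?_
    ring
  exact (M.isUnit_natCast_add_two p).mul_right_eq_zero.mp htot

/-- Umbilicity of an eigenspace, with the trace given by the gradient of its eigenvalue, is
equivalent to the components of the Killing equation with at least two arguments in it. -/
theorem umbilicalWith_iff_killingOp (hv : G.IsProjector v) {p : ℕ}
    (hd : G.ptrace v = (p : M.F)) {α β : M.F} (hab : IsUnit (α - β)) :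
    G.UmbilicalWith v (Ring.inverse (β - α) • G.grad α) ↔
      (∀ x y z, v x = x → v y = y → v z = z → G.killingOp (G.apTensor v α β) x y z = 0) ∧
      (∀ x y z, v x = x → v y = y → v z = 0 → G.killingOp (G.apTensor v α β) x y z = 0) := by
  have hba : IsUnit (β - α) := by simpa using hab.neg
  have hinv := Ring.mul_inverse_cancel _ hba
  constructor
  · intro hu
    have key (x y z : M.X) (hx : v x = x) (hy : v y = y) :
        (β - α) * G.g (G.sb x y) (G.co v z) = G.g x y * M.act z α := by
      have := congrArg (G.g · z) (hu x y)
      simp only [g_Qv_add_Qv hv, G.g_smull, G.g_grad, hx, hy] at this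
      rw [this]
      linear_combination G.g x y * M.act z α * hinv
    constructor
    · intro x y z hx hy hz
      have flat (x y z : M.X) (hx : v x = x) (hy : v y = y) (hz : v z = z) :
          G.g x y * M.act z α = 0 := by
        rw [← key x y z hx hy, Metric.co, hz, sub_self, G.g_zeror, mul_zero]
      rw [killingOp_apTensor_of_mem hv α β hx hy hz]
      linear_combination flat y z x hy hz hx + flat z x y hz hx hy + flat x y z hx hy hz
    · intro x y z hx hy hz
      have := key x y z hx hy
      rw [Metric.co, hz, sub_zero] at this
      rw [killingOp_apTensor_mixed hv α β hx hy hz]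
      linear_combination -this
  · rintro ⟨hV, hVH⟩ x y
    apply G.g_nondegenerate
    intro z
    have hm := hVH (v x) (v y) (G.co v z) (hv.2.2.1 x) (hv.2.2.1 y) (hv.apply_co z)
    rw [killingOp_apTensor_mixed hv α β (hv.2.2.1 x) (hv.2.2.1 y) (hv.apply_co z)] at hm
    have hz : M.act z α = M.act (G.co v z) α := by
      have := M.act_addv (G.co v z) (v z) α
      rwa [act_eq_zero_of_killingOp hv hd hV (hv.2.2.1 z), add_zero, Metric.co,
        sub_add_cancel] at this
    rw [g_Qv_add_Qv hv, G.g_smull, G.g_smull, G.g_grad, hz]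
    linear_combination -G.g (G.sb (v x) (v y)) (G.co v z) * hinv - Ring.inverse (β - α) * hm

end Metric

/-- Proposition 2: `K = α v + β h` is a Killing tensor iff the
eigenstructure is umbilical and `a = (1/(β-α)) dα`, `b = (1/(α-β)) dβ`. -/
theorem stmt_8 {M : Man} {n : ℕ} (G : Metric M n) (p q : ℕ) (hpq : p + q = n)
    (v : M.X → M.X) (hv : G.IsProjector v) (hd : G.ptrace v = (p : M.F))
    (α β : M.F) (hab : IsUnit (α - β)) :
    G.IsKilling (G.apTensor v α β) ↔
      ∃ a b : M.X, G.UmbilicalWith v a ∧ G.UmbilicalWith (G.co v) b ∧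
        a = Ring.inverse (β - α) • G.grad α ∧ b = Ring.inverse (α - β) • G.grad β := by
  have hco (x : M.X) : G.co v x = x ↔ v x = 0 := by simp [Metric.co]
  have hco' (x : M.X) : G.co v x = 0 ↔ v x = x := by
    rw [Metric.co, sub_eq_zero, eq_comm]
  have hba : IsUnit (β - α) := by simpa using hab.neg
  have hV := Metric.umbilicalWith_iff_killingOp hv hd hab
  have hH := Metric.umbilicalWith_iff_killingOp hv.co (Metric.ptrace_co hpq hd) hba
  simp only [Metric.apTensor_co, hco, hco'] at hH
  have hB := Metric.bilin_apTensor hv α β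
  constructor
  · rintro ⟨-, -, hK⟩
    exact ⟨_, _, hV.2 ⟨fun x y z _ _ _ => hK x y z, fun x y z _ _ _ => hK x y z⟩,
      hH.2 ⟨fun x y z _ _ _ => hK x y z, fun x y z _ _ _ => hK x y z⟩, rfl, rfl⟩
  · rintro ⟨a, b, ha, hb, rfl, rfl⟩
    obtain ⟨hVVV, hVVH⟩ := hV.1 ha
    obtain ⟨hHHH, hHHV⟩ := hH.1 hb
    refine ⟨hB, Metric.symm2_apTensor hv α β, ?_⟩
    have split {y z : M.X} (h₁ : ∀ x, v x = x → G.killingOp (G.apTensor v α β) x y z = 0)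
        (h₂ : ∀ x, v x = 0 → G.killingOp (G.apTensor v α β) x y z = 0) (x : M.X) :
        G.killingOp (G.apTensor v α β) x y z = 0 := by
      rw [← add_sub_cancel (v x) x, G.killingOp_add hB, h₁ _ (hv.2.2.1 x),
        zero_add]
      exact h₂ _ (hv.apply_co x)
    intro x y z
    refine split (fun x hx => ?_) (fun x hx => ?_) x <;> rw [G.killingOp_cyclic] <;>
      refine split (fun y hy => ?_) (fun y hy => ?_) y <;> rw [G.killingOp_cyclic] <;>
      refine split (fun z hz => ?_) (fun z hz => ?_) z
    · exact hVVV z x y hz hx hy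
    · rw [G.killingOp_cyclic]
      exact hVVH x y z hx hy hz
    · exact hVVH z x y hz hx hy
    · rw [← G.killingOp_cyclic]
      exact hHHV y z x hy hz hx
    · rw [← G.killingOp_cyclic]
      exact hVVH y z x hy hz hx
    · exact hHHV z x y hz hx hy
    · rw [G.killingOp_cyclic]
      exact hHHV x y z hx hy hz
    · exact hHHH z x y hz hx hy

end KCT
end
end
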